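/- There exists a constant C > 0, depending only on ‖a‖_∞, μ₁, μ₂ and L, such that for every T > 0 and every classical solution ζ of the linear μ-system, the Kato smoothing estimate (3α/2)∫₀^T∫_Ω (∂ₓζ(x,y,t))² dx dy dt ≤ C (1+T) ‖(ζ₀,z₀)‖²_H holds. -/

import Mathlib

open MeasureTheory intervalIntegral Set

noncomputable section

/-- Partial derivative in time. -/
def pT (ζ : ℝ → ℝ → ℝ → ℝ) (x y t : ℝ) : ℝ := deriv (fun τ => ζ x y τ) t
/-- Partial derivative in `x`. -/
def pX (ζ : ℝ → ℝ → ℝ → ℝ) (x y t : ℝ) : ℝ := deriv (fun s => ζ s y t) x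
/-- Third partial derivative in `x`. -/
def pX3 (ζ : ℝ → ℝ → ℝ → ℝ) (x y t : ℝ) : ℝ := iteratedDeriv 3 (fun s => ζ s y t) x
/-- Partial derivative in `y`. -/
def pY (ζ : ℝ → ℝ → ℝ → ℝ) (x y t : ℝ) : ℝ := deriv (fun r => ζ x r t) y
/-- Mixed derivative `∂ₓ∂ᵧ²`. -/
def pXYY (ζ : ℝ → ℝ → ℝ → ℝ) (x y t : ℝ) : ℝ :=
  deriv (fun s => iteratedDeriv 2 (fun r => ζ s r t) y) x

/-- Smoothness of a function of three real variables. -/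
def Smooth3 (ζ : ℝ → ℝ → ℝ → ℝ) : Prop :=
  ContDiff ℝ (⊤ : ℕ∞) (fun p : ℝ × ℝ × ℝ => ζ p.1 p.2.1 p.2.2)

/-- Boundary conditions of the ZK-type systems on `Ω = (0,L)×(0,L)`. -/
def ZKbc (L : ℝ) (ζ : ℝ → ℝ → ℝ → ℝ) : Prop :=
  ∀ t > (0:ℝ),
    (∀ y ∈ Ioo (0:ℝ) L,
      ζ 0 y t = 0 ∧ ζ L y t = 0 ∧ pX ζ L y t = 0 ∧ pY ζ L y t = 0) ∧
    (∀ x ∈ Ioo (0:ℝ) L, ζ x 0 t = 0 ∧ ζ x L t = 0)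

/-- `M` is the essential supremum of `f` on `Ω = (0,L)×(0,L)`:
the greatest lower bound of the set of a.e. upper bounds. -/
def IsEssSupOn (L : ℝ) (f : ℝ → ℝ → ℝ) (M : ℝ) : Prop :=
  IsGLB {c : ℝ | ∀ᵐ p ∂(volume.restrict (Ioo (0:ℝ) L ×ˢ Ioo (0:ℝ) L)),
    f p.1 p.2 ≤ c} M

/-- Bounded, nonnegative, measurable coefficient. -/
def Coeff (f : ℝ → ℝ → ℝ) : Prop :=
  Measurable (fun p : ℝ × ℝ => f p.1 p.2) ∧ (∀ x y, 0 ≤ f x y) ∧ ∃ M, ∀ x y, f x y ≤ M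

/-- Squared `H`-norm of an initial state, with weight `w` on the delay component. -/
def Hn2 (L w : ℝ) (f : ℝ → ℝ → ℝ) (g : ℝ → ℝ → ℝ → ℝ) : ℝ :=
  (∫ x in (0:ℝ)..L, ∫ y in (0:ℝ)..L, (f x y)^2)
  + w * (∫ x in (0:ℝ)..L, ∫ y in (0:ℝ)..L, ∫ ρ in (0:ℝ)..1, (g x y ρ)^2)

/-- `L²(Ω)` norm of `w(·,·,t)`. -/
def L2n (L : ℝ) (w : ℝ → ℝ → ℝ → ℝ) (t : ℝ) : ℝ :=
  Real.sqrt (∫ x in (0:ℝ)..L, ∫ y in (0:ℝ)..L, (w x y t)^2)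

/-- Squared `H¹(Ω)` norm of `w(·,·,t)`. -/
def H1n2 (L : ℝ) (w : ℝ → ℝ → ℝ → ℝ) (t : ℝ) : ℝ :=
  ∫ x in (0:ℝ)..L, ∫ y in (0:ℝ)..L,
    ((w x y t)^2 + (pX w x y t)^2 + (pY w x y t)^2)

/-- Classical solution of the delayed ZK system. -/
def IsZKSol (L α γ h : ℝ) (a b : ℝ → ℝ → ℝ) (ζ : ℝ → ℝ → ℝ → ℝ) : Prop :=
  Smooth3 ζ ∧ ZKbc L ζ ∧
  ∀ x ∈ Ioo (0:ℝ) L, ∀ y ∈ Ioo (0:ℝ) L, ∀ t > (0:ℝ),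
    pT ζ x y t + α * pX3 ζ x y t + γ * pXYY ζ x y t + ζ x y t * pX ζ x y t
      + a x y * ζ x y t + b x y * ζ x y (t - h) = 0

/-- Energy of the delayed ZK system. -/
def zkE (L h : ℝ) (b : ℝ → ℝ → ℝ) (ζ : ℝ → ℝ → ℝ → ℝ) (t : ℝ) : ℝ :=
  (1/2) * (∫ x in (0:ℝ)..L, ∫ y in (0:ℝ)..L, (ζ x y t)^2)
  + (h/2) * (∫ x in (0:ℝ)..L, ∫ y in (0:ℝ)..L, ∫ ρ in (0:ℝ)..1,
      b x y * (ζ x y (t - ρ*h))^2)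

/-- Classical solution of the (nonlinear) μ-system. -/
def IsMuSol (L α γ h μ₁ μ₂ : ℝ) (a : ℝ → ℝ → ℝ) (ζ : ℝ → ℝ → ℝ → ℝ) : Prop :=
  Smooth3 ζ ∧ ZKbc L ζ ∧
  ∀ x ∈ Ioo (0:ℝ) L, ∀ y ∈ Ioo (0:ℝ) L, ∀ t > (0:ℝ),
    pT ζ x y t + α * pX3 ζ x y t + γ * pXYY ζ x y t + ζ x y t * pX ζ x y t
      + a x y * (μ₁ * ζ x y t + μ₂ * ζ x y (t - h)) = 0

/-- Classical solution of the linear μ-system with source `f`. -/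
def IsLinMuSolF (L α γ h μ₁ μ₂ : ℝ) (a : ℝ → ℝ → ℝ) (f : ℝ → ℝ → ℝ → ℝ)
    (ζ : ℝ → ℝ → ℝ → ℝ) : Prop :=
  Smooth3 ζ ∧ ZKbc L ζ ∧
  ∀ x ∈ Ioo (0:ℝ) L, ∀ y ∈ Ioo (0:ℝ) L, ∀ t > (0:ℝ),
    pT ζ x y t + α * pX3 ζ x y t + γ * pXYY ζ x y t
      + a x y * (μ₁ * ζ x y t + μ₂ * ζ x y (t - h)) = f x y t

/-- Classical solution of the linear μ-system. -/
def IsLinMuSol (L α γ h μ₁ μ₂ : ℝ) (a : ℝ → ℝ → ℝ) (ζ : ℝ → ℝ → ℝ → ℝ) : Prop :=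
  IsLinMuSolF L α γ h μ₁ μ₂ a (fun _ _ _ => 0) ζ

/-- Energy of the μ-system. -/
def muE (L h ξ : ℝ) (a : ℝ → ℝ → ℝ) (ζ : ℝ → ℝ → ℝ → ℝ) (t : ℝ) : ℝ :=
  (1/2) * (∫ x in (0:ℝ)..L, ∫ y in (0:ℝ)..L, (ζ x y t)^2)
  + (ξ/2) * (∫ x in (0:ℝ)..L, ∫ y in (0:ℝ)..L, ∫ ρ in (0:ℝ)..1,
      a x y * (ζ x y (t - ρ*h))^2)

/-- Classical solution of the perturbed delayed ZK system with source `f`. -/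
def IsPertSol (L α γ h ξ : ℝ) (a b : ℝ → ℝ → ℝ) (f : ℝ → ℝ → ℝ → ℝ)
    (ζ : ℝ → ℝ → ℝ → ℝ) : Prop :=
  Smooth3 ζ ∧ ZKbc L ζ ∧
  ∀ x ∈ Ioo (0:ℝ) L, ∀ y ∈ Ioo (0:ℝ) L, ∀ t > (0:ℝ),
    pT ζ x y t + α * pX3 ζ x y t + γ * pXYY ζ x y t
      + a x y * ζ x y t + b x y * (ξ * ζ x y t + ζ x y (t - h)) = f x y t

/-- Energy `E_ξ` of the perturbed delayed ZK system. -/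
def pertE (L h ξ : ℝ) (b : ℝ → ℝ → ℝ) (ζ : ℝ → ℝ → ℝ → ℝ) (t : ℝ) : ℝ :=
  (1/2) * (∫ x in (0:ℝ)..L, ∫ y in (0:ℝ)..L, (ζ x y t)^2)
  + (ξ*h/2) * (∫ x in (0:ℝ)..L, ∫ y in (0:ℝ)..L, ∫ ρ in (0:ℝ)..1,
      b x y * (ζ x y (t - ρ*h))^2)

/-- The derivative of `F` at `p` in the direction `v`. -/
def dirDeriv {E : Type*} [NormedAddCommGroup E] [NormedSpace ℝ E] (v : E) (F : E → ℝ) (p : E) :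
    ℝ := fderiv ℝ F p v

section DirDeriv

variable {E : Type*} [NormedAddCommGroup E] [NormedSpace ℝ E] {F : E → ℝ}

theorem ContDiff.dirDeriv (hF : ContDiff ℝ (⊤ : ℕ∞) F) (v : E) :
    ContDiff ℝ (⊤ : ℕ∞) (dirDeriv v F) :=
  (hF.fderiv_right (m := (⊤ : ℕ∞)) (by norm_cast)).clm_apply contDiff_const

theorem dirDeriv_comm (hF : ContDiff ℝ (⊤ : ℕ∞) F) (v w : E) :
    dirDeriv v (dirDeriv w F) = dirDeriv w (dirDeriv v F) := by
  have hd : Differentiable ℝ (fderiv ℝ F) :=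
    (hF.fderiv_right (m := (⊤ : ℕ∞)) (by norm_cast)).differentiable (by simp)
  have key : ∀ (a b p : E),
      dirDeriv a (dirDeriv b F) p = fderiv ℝ (fderiv ℝ F) p a b := by
    intro a b p
    have h := ((hd p).hasFDerivAt.clm_apply (hasFDerivAt_const b p)).fderiv
    change fderiv ℝ (fun q => fderiv ℝ F q b) p a = _
    rw [h]
    simp
  funext p
  rw [key, key]
  exact (hF.contDiffAt.isSymmSndFDerivAt (by simp; norm_cast)) v w

end DirDeriv

section Partials

variable {F : ℝ × ℝ × ℝ → ℝ}

theorem hasDerivAt_fst (hF : ContDiff ℝ (⊤ : ℕ∞) F) (x y t : ℝ) :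
    HasDerivAt (fun s => F (s, y, t)) (dirDeriv (1, 0, 0) F (x, y, t)) x :=
  (hF.differentiable (by simp) (x, y, t)).hasFDerivAt.comp_hasDerivAt x
    ((hasDerivAt_id x).prodMk ((hasDerivAt_const x y).prodMk (hasDerivAt_const x t)))

theorem hasDerivAt_snd (hF : ContDiff ℝ (⊤ : ℕ∞) F) (x y t : ℝ) :
    HasDerivAt (fun r => F (x, r, t)) (dirDeriv (0, 1, 0) F (x, y, t)) y :=
  (hF.differentiable (by simp) (x, y, t)).hasFDerivAt.comp_hasDerivAt y
    ((hasDerivAt_const y x).prodMk ((hasDerivAt_id y).prodMk (hasDerivAt_const y t)))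

theorem hasDerivAt_trd (hF : ContDiff ℝ (⊤ : ℕ∞) F) (x y t : ℝ) :
    HasDerivAt (fun τ => F (x, y, τ)) (dirDeriv (0, 0, 1) F (x, y, t)) t :=
  (hF.differentiable (by simp) (x, y, t)).hasFDerivAt.comp_hasDerivAt t
    ((hasDerivAt_const t x).prodMk ((hasDerivAt_const t y).prodMk (hasDerivAt_id t)))

theorem pX_eq_dirDeriv (hF : ContDiff ℝ (⊤ : ℕ∞) F) (x y t : ℝ) :
    pX (fun x y t => F (x, y, t)) x y t = dirDeriv (1, 0, 0) F (x, y, t) :=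
  (hasDerivAt_fst hF x y t).deriv

theorem pY_eq_dirDeriv (hF : ContDiff ℝ (⊤ : ℕ∞) F) (x y t : ℝ) :
    pY (fun x y t => F (x, y, t)) x y t = dirDeriv (0, 1, 0) F (x, y, t) :=
  (hasDerivAt_snd hF x y t).deriv

theorem pT_eq_dirDeriv (hF : ContDiff ℝ (⊤ : ℕ∞) F) (x y t : ℝ) :
    pT (fun x y t => F (x, y, t)) x y t = dirDeriv (0, 0, 1) F (x, y, t) :=
  (hasDerivAt_trd hF x y t).deriv

theorem pX3_eq_dirDeriv (hF : ContDiff ℝ (⊤ : ℕ∞) F) (x y t : ℝ) :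
    pX3 (fun x y t => F (x, y, t)) x y t =
      dirDeriv (1, 0, 0) (dirDeriv (1, 0, 0) (dirDeriv (1, 0, 0) F)) (x, y, t) := by
  have h : ∀ {G : ℝ × ℝ × ℝ → ℝ}, ContDiff ℝ (⊤ : ℕ∞) G →
      deriv (fun s => G (s, y, t)) = fun s => dirDeriv (1, 0, 0) G (s, y, t) :=
    fun hG => funext fun s => (hasDerivAt_fst hG s y t).deriv
  simp only [pX3, iteratedDeriv_succ, iteratedDeriv_zero]
  rw [h hF, h (hF.dirDeriv _), h ((hF.dirDeriv _).dirDeriv _)]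

theorem pXYY_eq_dirDeriv (hF : ContDiff ℝ (⊤ : ℕ∞) F) (x y t : ℝ) :
    pXYY (fun x y t => F (x, y, t)) x y t =
      dirDeriv (1, 0, 0) (dirDeriv (0, 1, 0) (dirDeriv (0, 1, 0) F)) (x, y, t) := by
  have h : ∀ {G : ℝ × ℝ × ℝ → ℝ}, ContDiff ℝ (⊤ : ℕ∞) G → ∀ s,
      deriv (fun r => G (s, r, t)) = fun r => dirDeriv (0, 1, 0) G (s, r, t) :=
    fun hG s => funext fun r => (hasDerivAt_snd hG s r t).deriv
  simp only [pXYY, iteratedDeriv_succ, iteratedDeriv_zero, h hF, h (hF.dirDeriv _)]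
  exact (hasDerivAt_fst ((hF.dirDeriv _).dirDeriv _) x y t).deriv

end Partials

section OneVariable

theorem integral_id_mul_self_mul_third_deriv {L : ℝ} {f f₁ f₂ f₃ : ℝ → ℝ}
    (h₁ : ∀ x, HasDerivAt f (f₁ x) x) (h₂ : ∀ x, HasDerivAt f₁ (f₂ x) x)
    (h₃ : ∀ x, HasDerivAt f₂ (f₃ x) x) (hc : Continuous f₃)
    (f_zero : f 0 = 0) (f_L : f L = 0) (f₁_L : f₁ L = 0) :
    ∫ x in (0:ℝ)..L, x * (f x * f₃ x) = (3/2) * ∫ x in (0:ℝ)..L, (f₁ x)^2 := by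
  have c : Continuous f := continuous_iff_continuousAt.2 fun x => (h₁ x).continuousAt
  have c₁ : Continuous f₁ := continuous_iff_continuousAt.2 fun x => (h₂ x).continuousAt
  have key : ∫ x in (0:ℝ)..L, (x * (f x * f₃ x) - (3/2) * (f₁ x)^2) = 0 := by
    rw [integral_eq_sub_of_hasDerivAt
      (f := fun x => x * (f x * f₂ x) - f x * f₁ x - (1/2) * (x * (f₁ x * f₁ x)))
      (fun x _ => ?_) (by apply Continuous.intervalIntegrable; fun_prop)]
    · simp [f_zero, f_L, f₁_L]
    · refine ((((hasDerivAt_id x).mul ((h₁ x).mul (h₃ x))).sub ((h₁ x).mul (h₂ x))).sub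
        (((hasDerivAt_id x).mul ((h₂ x).mul (h₂ x))).const_mul (1/2))).congr_deriv ?_
      simp
      ring
  rw [intervalIntegral.integral_sub (by apply Continuous.intervalIntegrable; fun_prop)
    (by apply Continuous.intervalIntegrable; fun_prop),
    intervalIntegral.integral_const_mul] at key
  linarith

theorem integral_id_mul_self_mul_deriv {L : ℝ} {f f₁ : ℝ → ℝ}
    (h₁ : ∀ x, HasDerivAt f (f₁ x) x) (hc : Continuous f₁) (f_L : f L = 0) :
    ∫ x in (0:ℝ)..L, x * (f x * f₁ x) = -(1/2) * ∫ x in (0:ℝ)..L, (f x)^2 := by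
  have c : Continuous f := continuous_iff_continuousAt.2 fun x => (h₁ x).continuousAt
  have key : ∫ x in (0:ℝ)..L, (x * (f x * f₁ x) + (1/2) * (f x)^2) = 0 := by
    rw [integral_eq_sub_of_hasDerivAt (f := fun x => (1/2) * (x * (f x * f x)))
      (fun x _ => ?_) (by apply Continuous.intervalIntegrable; fun_prop)]
    · simp [f_L]
    · refine (((hasDerivAt_id x).mul ((h₁ x).mul (h₁ x))).const_mul (1/2)).congr_deriv ?_
      simp
      ring
  rw [intervalIntegral.integral_add (by apply Continuous.intervalIntegrable; fun_prop)
    (by apply Continuous.intervalIntegrable; fun_prop),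
    intervalIntegral.integral_const_mul] at key
  linarith

theorem integral_mul_deriv_eq_neg_of_boundary_zero {L : ℝ} {f f₁ g g₁ : ℝ → ℝ}
    (hf : ∀ x, HasDerivAt f (f₁ x) x) (hg : ∀ x, HasDerivAt g (g₁ x) x)
    (cf : Continuous f₁) (cg : Continuous g₁) (f_zero : f 0 = 0) (f_L : f L = 0) :
    ∫ x in (0:ℝ)..L, f x * g₁ x = -∫ x in (0:ℝ)..L, f₁ x * g x := by
  rw [integral_mul_deriv_eq_deriv_mul (fun x _ => hf x) (fun x _ => hg x)
    (cf.intervalIntegrable _ _) (cg.intervalIntegrable _ _), f_zero, f_L]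
  ring

/-- Energy inequality for a scalar delay equation with damping dominating the delayed term. -/
theorem integral_mul_le_of_delay_equation {h T a μ₁ μ₂ : ℝ} (hh : 0 < h) (hT : 0 < T)
    (ha : 0 ≤ a) (hμ₂ : 0 < μ₂) (hμ : μ₂ < μ₁) {f f₁ g : ℝ → ℝ}
    (hf : ∀ t, HasDerivAt f (f₁ t) t) (cf₁ : Continuous f₁)
    (heq : ∀ t > 0, f₁ t + g t + a * (μ₁ * f t + μ₂ * f (t - h)) = 0) (cg : Continuous g) :
    ∫ t in (0:ℝ)..T, f t * g t ≤
      (1/2) * (f 0)^2 + (a * μ₂ * h / 2) * ∫ ρ in (0:ℝ)..1, (f (-(ρ*h)))^2 := by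
  have c : Continuous f := continuous_iff_continuousAt.2 fun x => (hf x).continuousAt
  have ii : ∀ {φ : ℝ → ℝ} (p q : ℝ), Continuous φ → IntervalIntegrable φ volume p q :=
    fun p q hφ => hφ.intervalIntegrable p q
  have ftc : ∫ t in (0:ℝ)..T, f t * f₁ t = (1/2) * (f T)^2 - (1/2) * (f 0)^2 := by
    rw [integral_eq_sub_of_hasDerivAt (f := fun t => (1/2) * (f t * f t))
      (fun t _ => ?_) (ii _ _ (by fun_prop))]
    · ring
    · refine (((hf t).mul (hf t)).const_mul (1/2)).congr_deriv ?_
      ring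
  have shift : ∫ t in (0:ℝ)..T, (f (t - h))^2 ≤
      h * (∫ ρ in (0:ℝ)..1, (f (-(ρ*h)))^2) + ∫ t in (0:ℝ)..T, (f t)^2 := by
    have e₁ : ∫ t in (0:ℝ)..T, (f (t - h))^2 = ∫ t in (-h)..(T - h), (f t)^2 := by
      rw [intervalIntegral.integral_comp_sub_right (fun t => (f t)^2) h, zero_sub]
    have e₂ : h * (∫ ρ in (0:ℝ)..1, (f (-(ρ*h)))^2) = ∫ t in (-h)..0, (f t)^2 := by
      have := intervalIntegral.smul_integral_comp_mul_right (a := 0) (b := 1)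
        (fun t => (f (-t))^2) h
      rw [smul_eq_mul, intervalIntegral.integral_comp_neg (fun t => (f t)^2)] at this
      simpa using this
    have c2 : Continuous fun t => (f t)^2 := by fun_prop
    have e₃ := intervalIntegral.integral_add_adjacent_intervals (ii (-h) (T - h) c2)
      (ii (T - h) T c2)
    have e₄ := intervalIntegral.integral_add_adjacent_intervals (ii (-h) 0 c2) (ii 0 T c2)
    have e₅ : 0 ≤ ∫ t in (T - h)..T, (f t)^2 :=
      intervalIntegral.integral_nonneg (by linarith) fun t _ => sq_nonneg _
    linarith
  have young : ∫ t in (0:ℝ)..T, f t * g t ≤ ∫ t in (0:ℝ)..T,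
      (-(f t * f₁ t) - (a * (μ₁ - μ₂/2)) * (f t)^2 + (a * μ₂ / 2) * (f (t - h))^2) := by
    refine intervalIntegral.integral_mono_on_of_le_Ioo hT.le (ii _ _ (by fun_prop))
      (ii _ _ (by fun_prop)) fun t ht => ?_
    have hg : g t = -f₁ t - a * (μ₁ * f t + μ₂ * f (t - h)) := by linarith [heq t ht.1]
    rw [hg]
    nlinarith [mul_nonneg (mul_nonneg ha hμ₂.le) (sq_nonneg (f t + f (t - h)))]
  rw [intervalIntegral.integral_add (ii _ _ (by fun_prop)) (ii _ _ (by fun_prop)),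
    intervalIntegral.integral_sub (ii _ _ (by fun_prop)) (ii _ _ (by fun_prop)),
    intervalIntegral.integral_neg, intervalIntegral.integral_const_mul,
    intervalIntegral.integral_const_mul, ftc] at young
  have nonneg : 0 ≤ ∫ t in (0:ℝ)..T, (f t)^2 :=
    intervalIntegral.integral_nonneg hT.le fun t _ => sq_nonneg _
  have h₁ := mul_le_mul_of_nonneg_left shift (by positivity : 0 ≤ a * μ₂ / 2)
  have h₂ := mul_nonneg (mul_nonneg ha (sub_pos.2 hμ).le) nonneg
  nlinarith [sq_nonneg (f T)]

end OneVariable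

section Iterated

theorem integral_integral_swap_of_continuous {a b c d : ℝ} {f : ℝ → ℝ → ℝ}
    (hf : Continuous fun p : ℝ × ℝ => f p.1 p.2) :
    ∫ x in a..b, ∫ y in c..d, f x y = ∫ y in c..d, ∫ x in a..b, f x y := by
  refine intervalIntegral_intervalIntegral_swap ?_
  exact (hf.continuousOn.integrableOn_compact (isCompact_uIcc.prod isCompact_uIcc)).mono_set
    (prod_mono uIoc_subset_uIcc uIoc_subset_uIcc)

theorem integral_integral_mono_of_ae_le {L : ℝ} (hL : 0 ≤ L) {f g : ℝ → ℝ → ℝ}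
    (hf : Continuous fun p : ℝ × ℝ => f p.1 p.2) (hg : Continuous fun p : ℝ × ℝ => g p.1 p.2)
    (h : ∀ᵐ p ∂(volume.restrict (Ioo (0:ℝ) L ×ˢ Ioo (0:ℝ) L)), f p.1 p.2 ≤ g p.1 p.2) :
    ∫ x in (0:ℝ)..L, ∫ y in (0:ℝ)..L, f x y ≤ ∫ x in (0:ℝ)..L, ∫ y in (0:ℝ)..L, g x y := by
  have mono : ∀ {φ ψ : ℝ → ℝ}, Continuous φ → Continuous ψ →
      (∀ᵐ x ∂(volume.restrict (Ioo (0:ℝ) L)), φ x ≤ ψ x) →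
      ∫ x in (0:ℝ)..L, φ x ≤ ∫ x in (0:ℝ)..L, ψ x := by
    intro φ ψ hφ hψ hle
    refine intervalIntegral.integral_mono_ae_restrict hL (hφ.intervalIntegrable _ _)
      (hψ.intervalIntegrable _ _) ?_
    rwa [Measure.restrict_congr_set Ioo_ae_eq_Icc] at hle
  rw [Measure.volume_eq_prod, ← Measure.prod_restrict] at h
  refine mono (by fun_prop) (by fun_prop) ?_
  filter_upwards [Measure.ae_ae_of_ae_prod h] with x hx
  exact mono (by fun_prop) (by fun_prop) hx

end Iterated

theorem IsEssSupOn.ae_le {L M : ℝ} {f : ℝ → ℝ → ℝ} (hf : Coeff f) (hM : IsEssSupOn L f M) :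
    ∀ᵐ p ∂(volume.restrict (Ioo (0:ℝ) L ×ˢ Ioo (0:ℝ) L)), f p.1 p.2 ≤ M := by
  obtain ⟨B, hB⟩ := hf.2.2
  have hlt : ∀ n : ℕ, ∀ᵐ p ∂(volume.restrict (Ioo (0:ℝ) L ×ˢ Ioo (0:ℝ) L)),
      f p.1 p.2 ≤ M + 1 / ((n : ℝ) + 1) := by
    intro n
    obtain ⟨c, hc, -, hcn⟩ := hM.exists_between
      (lt_add_of_pos_right M (Nat.one_div_pos_of_nat (n := n)))
    filter_upwards [hc] with p hp using hp.trans hcn.le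
  filter_upwards [ae_all_iff.2 hlt] with p hp
  have htends := (tendsto_one_div_add_atTop_nhds_zero_nat (𝕜 := ℝ)).const_add M
  rw [add_zero] at htends
  exact ge_of_tendsto' htends hp

theorem IsEssSupOn.nonneg {L M : ℝ} (hL : 0 < L) {f : ℝ → ℝ → ℝ} (hf : Coeff f)
    (hM : IsEssSupOn L f M) : 0 ≤ M := by
  have hpos : volume (Ioo (0:ℝ) L ×ˢ Ioo (0:ℝ) L) ≠ 0 :=
    ((isOpen_Ioo.prod isOpen_Ioo).measure_pos _
      ((nonempty_Ioo.2 hL).prod (nonempty_Ioo.2 hL))).ne'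
  have : (ae (volume.restrict (Ioo (0:ℝ) L ×ˢ Ioo (0:ℝ) L))).NeBot := by
    rwa [ae_neBot, Ne, Measure.restrict_eq_zero]
  obtain ⟨p, hp⟩ := (hM.ae_le hf).exists
  exact (hf.2.1 _ _).trans hp

/-- The dispersive terms, tested against `x ζ`, control the `L²` norm of `∂ₓζ`. -/
theorem integral_sq_dirDeriv_le_integral_weighted {L α γ t : ℝ} (hL : 0 < L) (hγ : 0 < γ)
    {F : ℝ × ℝ × ℝ → ℝ} (hF : ContDiff ℝ (⊤ : ℕ∞) F)
    (hx : ∀ y ∈ Ioo (0:ℝ) L, F (0, y, t) = 0 ∧ F (L, y, t) = 0 ∧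
      dirDeriv (1, 0, 0) F (L, y, t) = 0 ∧ dirDeriv (0, 1, 0) F (L, y, t) = 0)
    (hy : ∀ x ∈ Ioo (0:ℝ) L, F (x, 0, t) = 0 ∧ F (x, L, t) = 0) :
    (3*α/2) * (∫ x in (0:ℝ)..L, ∫ y in (0:ℝ)..L, (dirDeriv (1, 0, 0) F (x, y, t))^2) ≤
      ∫ x in (0:ℝ)..L, ∫ y in (0:ℝ)..L, x * (F (x, y, t) *
        (α * dirDeriv (1, 0, 0) (dirDeriv (1, 0, 0) (dirDeriv (1, 0, 0) F)) (x, y, t) +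
          γ * dirDeriv (1, 0, 0) (dirDeriv (0, 1, 0) (dirDeriv (0, 1, 0) F)) (x, y, t))) := by
  set Fx := dirDeriv (1, 0, 0) F
  set Fy := dirDeriv (0, 1, 0) F
  have sx : ContDiff ℝ (⊤ : ℕ∞) Fx := hF.dirDeriv _
  have sy : ContDiff ℝ (⊤ : ℕ∞) Fy := hF.dirDeriv _
  have sxx := sx.dirDeriv (1, 0, 0)
  have sxy := sy.dirDeriv (1, 0, 0)
  have sxxx := sxx.dirDeriv (1, 0, 0)
  have sxyy := (sy.dirDeriv (0, 1, 0)).dirDeriv (1, 0, 0)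
  have hcomm : dirDeriv (1, 0, 0) (dirDeriv (0, 1, 0) Fy) =
      dirDeriv (0, 1, 0) (dirDeriv (1, 0, 0) Fy) := dirDeriv_comm sy _ _
  rw [hcomm] at sxyy ⊢
  have c := hF.continuous
  have cx := sx.continuous
  have cy := sy.continuous
  have cxy := sxy.continuous
  have cxxx := sxxx.continuous
  have cxyy := sxyy.continuous
  have ii : ∀ {φ : ℝ → ℝ} (p q : ℝ), Continuous φ → IntervalIntegrable φ volume p q :=
    fun p q hφ => hφ.intervalIntegrable p q
  have third : ∫ x in (0:ℝ)..L, ∫ y in (0:ℝ)..L,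
      x * (F (x, y, t) * dirDeriv (1, 0, 0) (dirDeriv (1, 0, 0) Fx) (x, y, t)) =
      (3/2) * ∫ x in (0:ℝ)..L, ∫ y in (0:ℝ)..L, (Fx (x, y, t))^2 := by
    rw [integral_integral_swap_of_continuous (by fun_prop),
      integral_integral_swap_of_continuous (f := fun x y => (Fx (x, y, t))^2) (by fun_prop),
      ← intervalIntegral.integral_const_mul]
    refine intervalIntegral.integral_congr_Ioo_of_le hL.le fun y hyL => ?_
    obtain ⟨b₁, b₂, b₃, -⟩ := hx y hyL
    exact integral_id_mul_self_mul_third_deriv (fun x => hasDerivAt_fst hF x y t)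
      (fun x => hasDerivAt_fst sx x y t) (fun x => hasDerivAt_fst sxx x y t) (by fun_prop) b₁ b₂ b₃
  have mixed : ∫ x in (0:ℝ)..L, ∫ y in (0:ℝ)..L,
      x * (F (x, y, t) * dirDeriv (0, 1, 0) (dirDeriv (1, 0, 0) Fy) (x, y, t)) =
      (1/2) * ∫ y in (0:ℝ)..L, ∫ x in (0:ℝ)..L, (Fy (x, y, t))^2 := by
    have e₁ : ∫ x in (0:ℝ)..L, ∫ y in (0:ℝ)..L,
        x * (F (x, y, t) * dirDeriv (0, 1, 0) (dirDeriv (1, 0, 0) Fy) (x, y, t)) =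
        ∫ x in (0:ℝ)..L, ∫ y in (0:ℝ)..L,
          -(x * (Fy (x, y, t) * dirDeriv (1, 0, 0) Fy (x, y, t))) := by
      refine intervalIntegral.integral_congr_Ioo_of_le hL.le fun x hxL => ?_
      simp only [intervalIntegral.integral_neg, intervalIntegral.integral_const_mul]
      rw [integral_mul_deriv_eq_neg_of_boundary_zero (fun y => hasDerivAt_snd hF x y t)
        (fun y => hasDerivAt_snd sxy x y t) (cy.comp (by fun_prop)) (by fun_prop) (hy x hxL).1 (hy x hxL).2]
      ring
    rw [e₁, integral_integral_swap_of_continuous (by fun_prop),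
      ← intervalIntegral.integral_const_mul]
    refine intervalIntegral.integral_congr_Ioo_of_le hL.le fun y hyL => ?_
    simp only [intervalIntegral.integral_neg]
    rw [integral_id_mul_self_mul_deriv (fun x => hasDerivAt_fst sy x y t) (by fun_prop)
      (hx y hyL).2.2.2]
    ring
  have nonneg : 0 ≤ ∫ y in (0:ℝ)..L, ∫ x in (0:ℝ)..L, (Fy (x, y, t))^2 :=
    intervalIntegral.integral_nonneg hL.le fun y _ =>
      intervalIntegral.integral_nonneg hL.le fun x _ => sq_nonneg _
  have split : ∫ x in (0:ℝ)..L, ∫ y in (0:ℝ)..L, x * (F (x, y, t) *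
        (α * dirDeriv (1, 0, 0) (dirDeriv (1, 0, 0) Fx) (x, y, t) +
          γ * dirDeriv (0, 1, 0) (dirDeriv (1, 0, 0) Fy) (x, y, t))) =
      α * (∫ x in (0:ℝ)..L, ∫ y in (0:ℝ)..L,
        x * (F (x, y, t) * dirDeriv (1, 0, 0) (dirDeriv (1, 0, 0) Fx) (x, y, t))) +
      γ * ∫ x in (0:ℝ)..L, ∫ y in (0:ℝ)..L,
        x * (F (x, y, t) * dirDeriv (0, 1, 0) (dirDeriv (1, 0, 0) Fy) (x, y, t)) := by
    rw [← intervalIntegral.integral_const_mul, ← intervalIntegral.integral_const_mul,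
      ← intervalIntegral.integral_add (ii _ _ (by fun_prop)) (ii _ _ (by fun_prop))]
    congr 1
    funext x
    rw [← intervalIntegral.integral_const_mul, ← intervalIntegral.integral_const_mul,
      ← intervalIntegral.integral_add (ii _ _ (by fun_prop)) (ii _ _ (by fun_prop))]
    congr 1
    funext y
    ring
  rw [split, third, mixed]
  nlinarith [mul_nonneg hγ.le nonneg]

/-- Kato smoothing for the linear μ-system.
There is `C > 0` depending only on `‖a‖_∞, μ₁, μ₂, L` such that for all `T > 0`
and all classical solutions, `(3α/2)∫₀ᵀ∫_Ω (∂ₓζ)² ≤ C(1+T)‖(ζ₀,z₀)‖²_H`. -/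
theorem linear_mu_kato_smoothing
    (L μ₁ μ₂ Ma : ℝ) (hL : 0 < L) (hμ₂ : 0 < μ₂) (hμ : μ₂ < μ₁) :
    ∃ C > (0:ℝ), ∀ α > (0:ℝ), ∀ γ > (0:ℝ), ∀ h > (0:ℝ), ∀ ξ : ℝ,
      h * μ₂ < ξ → ξ < h * (2*μ₁ - μ₂) →
      ∀ a : ℝ → ℝ → ℝ, Coeff a → IsEssSupOn L a Ma →
      ∀ T > (0:ℝ), ∀ ζ : ℝ → ℝ → ℝ → ℝ, IsLinMuSol L α γ h μ₁ μ₂ a ζ →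
        (3*α/2) * (∫ t in (0:ℝ)..T, ∫ x in (0:ℝ)..L, ∫ y in (0:ℝ)..L,
            (pX ζ x y t)^2)
          ≤ C * (1+T) *
            Hn2 L (ξ*Ma) (fun x y => ζ x y 0) (fun x y ρ => ζ x y (-(ρ*h))) := by
  refine ⟨L/2, by positivity, ?_⟩
  intro α hα γ hγ h hh ξ hξ _ a ha hMa T hT ζ ⟨hs, hbc, hpde⟩
  obtain ⟨F, rfl⟩ : ∃ F : ℝ × ℝ × ℝ → ℝ, ζ = fun x y t => F (x, y, t) :=
    ⟨fun p => ζ p.1 p.2.1 p.2.2, rfl⟩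
  have hF : ContDiff ℝ (⊤ : ℕ∞) F := hs
  simp only [ZKbc, pX_eq_dirDeriv hF, pY_eq_dirDeriv hF] at hbc
  simp only [pT_eq_dirDeriv hF, pX3_eq_dirDeriv hF, pXYY_eq_dirDeriv hF] at hpde
  simp only [pX_eq_dirDeriv hF, Hn2]
  have hM := hMa.nonneg hL ha
  have hξ' : h * μ₂ * Ma ≤ ξ * Ma := mul_le_mul_of_nonneg_right hξ.le hM
  have hξM : 0 ≤ ξ * Ma := le_trans (by positivity) hξ'
  have c := hF.continuous
  have cx := (hF.dirDeriv (1, 0, 0)).continuous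
  set G : ℝ × ℝ × ℝ → ℝ := fun p =>
    α * dirDeriv (1, 0, 0) (dirDeriv (1, 0, 0) (dirDeriv (1, 0, 0) F)) p +
      γ * dirDeriv (1, 0, 0) (dirDeriv (0, 1, 0) (dirDeriv (0, 1, 0) F)) p with hG
  have cG : Continuous G := by
    have c₁ := (((hF.dirDeriv (1, 0, 0)).dirDeriv (1, 0, 0)).dirDeriv (1, 0, 0)).continuous
    have c₂ := (((hF.dirDeriv (0, 1, 0)).dirDeriv (0, 1, 0)).dirDeriv (1, 0, 0)).continuous
    fun_prop
  have ii : ∀ {φ : ℝ → ℝ} (p q : ℝ), Continuous φ → IntervalIntegrable φ volume p q :=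
    fun p q hφ => hφ.intervalIntegrable p q
  have dispersive : (3*α/2) * (∫ t in (0:ℝ)..T, ∫ x in (0:ℝ)..L, ∫ y in (0:ℝ)..L,
        (dirDeriv (1, 0, 0) F (x, y, t))^2) ≤
      ∫ t in (0:ℝ)..T, ∫ x in (0:ℝ)..L, ∫ y in (0:ℝ)..L, x * (F (x, y, t) * G (x, y, t)) := by
    rw [← intervalIntegral.integral_const_mul]
    exact intervalIntegral.integral_mono_on_of_le_Ioo hT.le (ii _ _ (by fun_prop))
      (ii _ _ (by fun_prop)) fun t ht =>
        integral_sq_dirDeriv_le_integral_weighted hL hγ hF (hbc t ht.1).1 (hbc t ht.1).2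
  have fubini : ∫ t in (0:ℝ)..T, ∫ x in (0:ℝ)..L, ∫ y in (0:ℝ)..L,
        x * (F (x, y, t) * G (x, y, t)) =
      ∫ x in (0:ℝ)..L, ∫ y in (0:ℝ)..L, x * ∫ t in (0:ℝ)..T, F (x, y, t) * G (x, y, t) := by
    rw [integral_integral_swap_of_continuous (by fun_prop)]
    congr 1
    funext x
    rw [integral_integral_swap_of_continuous (by fun_prop)]
    simp only [intervalIntegral.integral_const_mul]
  have bound : ∫ x in (0:ℝ)..L, ∫ y in (0:ℝ)..L,
        x * ∫ t in (0:ℝ)..T, F (x, y, t) * G (x, y, t) ≤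
      ∫ x in (0:ℝ)..L, ∫ y in (0:ℝ)..L,
        (L/2) * ((F (x, y, 0))^2 + ξ*Ma * ∫ ρ in (0:ℝ)..1, (F (x, y, -(ρ*h)))^2) := by
    refine integral_integral_mono_of_ae_le hL.le (by fun_prop) (by fun_prop) ?_
    filter_upwards [hMa.ae_le ha, ae_restrict_mem (measurableSet_Ioo.prod measurableSet_Ioo)]
      with ⟨x, y⟩ haM ⟨hx, hy⟩
    simp only at haM hx hy ⊢
    have hdelay := integral_mul_le_of_delay_equation (g := fun t => G (x, y, t)) hh hT
      (ha.2.1 x y) hμ₂ hμ (fun t => hasDerivAt_trd hF x y t)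
      (by have := (hF.dirDeriv (0, 0, 1)).continuous; fun_prop)
      (fun t ht => by have := hpde x hx y hy t ht; simp only [hG]; linarith) (by fun_prop)
    have hz : 0 ≤ ∫ ρ in (0:ℝ)..1, (F (x, y, -(ρ*h)))^2 :=
      intervalIntegral.integral_nonneg zero_le_one fun ρ _ => sq_nonneg _
    have haξ : a x y * μ₂ * h ≤ ξ * Ma := by
      have := mul_le_mul_of_nonneg_left haM (mul_pos hh hμ₂).le
      linarith
    have hle : ∫ t in (0:ℝ)..T, F (x, y, t) * G (x, y, t) ≤
        (1/2) * ((F (x, y, 0))^2 + ξ*Ma * ∫ ρ in (0:ℝ)..1, (F (x, y, -(ρ*h)))^2) := by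
      have := mul_le_mul_of_nonneg_right haξ hz
      linarith
    have hnn : 0 ≤ (1/2) * ((F (x, y, 0))^2 + ξ*Ma * ∫ ρ in (0:ℝ)..1, (F (x, y, -(ρ*h)))^2) := by
      positivity
    calc _ ≤ x * _ := mul_le_mul_of_nonneg_left hle hx.1.le
      _ ≤ L * _ := mul_le_mul_of_nonneg_right hx.2.le hnn
      _ = _ := by ring
  have norm_eq : ∫ x in (0:ℝ)..L, ∫ y in (0:ℝ)..L,
        (L/2) * ((F (x, y, 0))^2 + ξ*Ma * ∫ ρ in (0:ℝ)..1, (F (x, y, -(ρ*h)))^2) =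
      (L/2) * ((∫ x in (0:ℝ)..L, ∫ y in (0:ℝ)..L, (F (x, y, 0))^2) +
        ξ*Ma * ∫ x in (0:ℝ)..L, ∫ y in (0:ℝ)..L, ∫ ρ in (0:ℝ)..1, (F (x, y, -(ρ*h)))^2) := by
    simp only [intervalIntegral.integral_const_mul]
    rw [← intervalIntegral.integral_const_mul (ξ*Ma),
      ← intervalIntegral.integral_add (ii _ _ (by fun_prop)) (ii _ _ (by fun_prop))]
    congr 2
    funext x
    rw [← intervalIntegral.integral_const_mul (ξ*Ma),
      ← intervalIntegral.integral_add (ii _ _ (by fun_prop)) (ii _ _ (by fun_prop))]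
  have h₀ : 0 ≤ ∫ x in (0:ℝ)..L, ∫ y in (0:ℝ)..L, (F (x, y, 0))^2 :=
    intervalIntegral.integral_nonneg hL.le fun x _ =>
      intervalIntegral.integral_nonneg hL.le fun y _ => sq_nonneg _
  have h₁ : 0 ≤ ∫ x in (0:ℝ)..L, ∫ y in (0:ℝ)..L, ∫ ρ in (0:ℝ)..1, (F (x, y, -(ρ*h)))^2 :=
    intervalIntegral.integral_nonneg hL.le fun x _ =>
      intervalIntegral.integral_nonneg hL.le fun y _ =>
        intervalIntegral.integral_nonneg zero_le_one fun ρ _ => sq_nonneg _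
  refine (dispersive.trans (fubini.trans_le (bound.trans norm_eq.le))).trans ?_
  refine mul_le_mul_of_nonneg_right ?_ (by positivity)
  exact le_mul_of_one_le_right (by positivity) (by linarith)
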